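/- For all integers 1 ≤ k ≤ n, the binomial coefficient C(n,k) equals the sum, over all positive divisors d of gcd(k,n), of N_{k/d, n/d}. -/

import Mathlib

/-- A Young diagram inscribed in a `k × (n-k)` rectangle: a weakly decreasing
sequence `λ₁ ≥ … ≥ λ_k` (0-indexed) with all entries `≤ n - k`. -/
def IsDiagram (k n : ℕ) (lam : Fin k → ℕ) : Prop :=
  (∀ i j : Fin k, i ≤ j → lam j ≤ lam i) ∧ ∀ i, lam i ≤ n - k

/-- The cyclic step map `σ` on diagrams: add one box to every row if the first
row is shorter than `n - k`, otherwise drop the first row and append a zero row. -/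
def cyc (k n : ℕ) (lam : Fin k → ℕ) : Fin k → ℕ :=
  if ∀ i, lam i < n - k then fun i => lam i + 1
  else fun i => if h : (i : ℕ) + 1 < k then lam ⟨(i : ℕ) + 1, h⟩ else 0

/-- The orbit length `o(λ)`: the least positive `t` with `σ^[t] λ = λ`. -/
noncomputable def orbLen (k n : ℕ) (lam : Fin k → ℕ) : ℕ :=
  sInf {t | 0 < t ∧ (cyc k n)^[t] lam = lam}

/-- Upper triangular diagram: `k·λᵢ ≤ (n-k)(k-i)` for all `i` (1-indexed). -/
def IsUpper (k n : ℕ) (lam : Fin k → ℕ) : Prop :=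
  ∀ i : Fin k, k * lam i ≤ (n - k) * (k - 1 - (i : ℕ))

/-- Lexicographic (non-strict) comparison of diagrams. -/
def lexLE {k : ℕ} (lam mu : Fin k → ℕ) : Prop :=
  lam = mu ∨ ∃ t : Fin k, (∀ i, i < t → lam i = mu i) ∧ lam t < mu t

/-- Minimal upper triangular diagram: upper triangular and lexicographically
smallest among the upper triangular diagrams in its `σ`-orbit. -/
def IsMinUpper (k n : ℕ) (lam : Fin k → ℕ) : Prop :=
  IsUpper k n lam ∧
    ∀ t : ℕ, IsUpper k n ((cyc k n)^[t] lam) → lexLE lam ((cyc k n)^[t] lam)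

/-- The binary word of a diagram: position `j` (0-indexed) carries the symbol `0`
(encoded as `false`) iff `j = λ_{k-i} + i` for some `0 ≤ i ≤ k-1` (0-indexed). -/
def word (k n : ℕ) (lam : Fin k → ℕ) (j : Fin n) : Bool :=
  !decide (∃ i : Fin k, (j : ℕ) = lam i.rev + (i : ℕ))

/-- A binary word of length `n` with exactly `k` zeros (`false` encodes `0`). -/
def IsWord (k n : ℕ) (w : Fin n → Bool) : Prop :=
  (Finset.univ.filter fun j => w j = false).card = k

/-- Rotation of a binary word: `r(w)_j = w_{j+1}`, indices mod `n`. -/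
def rot {n : ℕ} (w : Fin n → Bool) (j : Fin n) : Bool :=
  w ⟨((j : ℕ) + 1) % n, Nat.mod_lt _ j.pos⟩

/-- The diagram `θ_{k,km} = ((k-1)(m-1), (k-2)(m-1), …, (m-1), 0)`. -/
def theta (k m : ℕ) : Fin k → ℕ := fun i => (k - 1 - (i : ℕ)) * (m - 1)

/-- `N_{k,n}`: the number of diagrams in `Y_{k,n}` with full orbit `o(λ) = n`. -/
noncomputable def NN (k n : ℕ) : ℕ :=
  {lam : Fin k → ℕ | IsDiagram k n lam ∧ orbLen k n lam = n}.ncard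

/-- The `n`-periodic binary sequence on `ℕ` whose true positions in `[0, n)` are the numbers
`λ_j + (k - j)` (1-indexed), i.e. the zeros of the word of the diagram. -/
def periodicWord (k n : ℕ) (lam : Fin k → ℕ) (z : ℕ) : Bool :=
  decide (∃ j : Fin k, lam j + (k - 1 - (j : ℕ)) = z % n)

/-- The `n`-periodic binary sequences with exactly `k` true positions in `[0, n)`. -/
def periodicSeqs (k n : ℕ) : Set (ℕ → Bool) :=
  {p | Function.Periodic p n ∧ Nat.count (fun z => p z = true) n = k}

/-- The members of `periodicSeqs k n` with no positive period smaller than `n`. -/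
def primitiveSeqs (k n : ℕ) : Set (ℕ → Bool) :=
  {p | p ∈ periodicSeqs k n ∧ ∀ t, 0 < t → Function.Periodic p t → n ≤ t}

theorem periodicWord_periodic (k n : ℕ) (lam : Fin k → ℕ) :
    Function.Periodic (periodicWord k n lam) n := by
  intro z
  simp [periodicWord]

theorem IsDiagram.cyc {k n : ℕ} {lam : Fin k → ℕ} (h : IsDiagram k n lam) :
    IsDiagram k n (cyc k n lam) := by
  obtain ⟨hanti, hle⟩ := h
  unfold _root_.cyc
  split_ifs with hlt
  · exact ⟨fun i j hij => Nat.add_le_add_right (hanti i j hij) 1, hlt⟩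
  · refine ⟨fun i j hij => ?_, fun i => ?_⟩
    · have hij' : (i : ℕ) ≤ j := hij
      dsimp only
      split_ifs with h1 h2
      · exact hanti _ _ (Fin.mk_le_mk.2 (Nat.succ_le_succ hij'))
      · omega
      · simp
      · simp
    · dsimp only
      split_ifs
      · exact hle _
      · simp

theorem IsDiagram.iterate_cyc {k n : ℕ} {lam : Fin k → ℕ} (h : IsDiagram k n lam) (t : ℕ) :
    IsDiagram k n ((_root_.cyc k n)^[t] lam) := by
  induction t with
  | zero => exact h
  | succ t ih => rw [Function.iterate_succ_apply']; exact ih.cyc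

theorem periodicWord_cyc {k n : ℕ} (hk : 1 ≤ k) (hkn : k ≤ n) {lam : Fin k → ℕ}
    (h : IsDiagram k n lam) (z : ℕ) :
    periodicWord k n (cyc k n lam) (z + 1) = periodicWord k n lam z := by
  obtain ⟨hanti, hle⟩ := h
  have hz : z % n < n := Nat.mod_lt _ (by omega)
  have hmod : (z + 1) % n = if z % n + 1 = n then 0 else z % n + 1 := by
    rw [Nat.add_mod_eq_ite]
    rcases Nat.eq_or_lt_of_le (show 1 ≤ n by omega) with h1 | h1
    · subst h1; simp [Nat.mod_one]
    · rw [Nat.mod_eq_of_lt h1]; split_ifs <;> omega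
  unfold periodicWord
  rw [decide_eq_decide, hmod]
  unfold cyc
  by_cases hlt : ∀ i, lam i < n - k
  · simp only [hlt, implies_true, if_true]
    refine exists_congr fun j => ?_
    have := hlt j
    have := j.isLt
    split_ifs <;> omega
  · rw [if_neg hlt]
    have h0 : lam ⟨0, hk⟩ = n - k := by
      push Not at hlt
      obtain ⟨i, hi⟩ := hlt
      have := hanti ⟨0, hk⟩ i (by simp [Fin.le_def])
      have := hle ⟨0, hk⟩
      omega
    constructor
    · rintro ⟨j, hj⟩
      have := j.isLt
      by_cases hjk : (j : ℕ) + 1 < k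
      · refine ⟨⟨j + 1, hjk⟩, ?_⟩
        simp only [hjk, dif_pos] at hj
        simp only
        split_ifs at hj <;> omega
      · refine ⟨⟨0, hk⟩, ?_⟩
        simp only [hjk, dif_neg, not_false_eq_true] at hj
        simp only [h0]
        split_ifs at hj <;> omega
    · rintro ⟨⟨j, hjk⟩, hj⟩
      simp only at hj
      rcases j with _ | j
      · refine ⟨⟨k - 1, by omega⟩, ?_⟩
        rw [h0] at hj
        have hk' : ¬ (k - 1 + 1 < k) := by omega
        simp only [hk', dif_neg, not_false_eq_true]
        split_ifs <;> omega
      · refine ⟨⟨j, by omega⟩, ?_⟩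
        have := hle ⟨j + 1, hjk⟩
        simp only [hjk, dif_pos]
        split_ifs <;> omega

theorem periodicWord_iterate_cyc {k n : ℕ} (hk : 1 ≤ k) (hkn : k ≤ n) {lam : Fin k → ℕ}
    (h : IsDiagram k n lam) (t z : ℕ) :
    periodicWord k n ((cyc k n)^[t] lam) (z + t) = periodicWord k n lam z := by
  induction t with
  | zero => rfl
  | succ t ih =>
    rw [Function.iterate_succ_apply', ← add_assoc, periodicWord_cyc hk hkn (h.iterate_cyc t), ih]

theorem add_sub_le_of_strictMono {k : ℕ} {f : Fin k → ℕ} (hf : StrictMono f) {i j : Fin k}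
    (hij : i ≤ j) : f i + ((j : ℕ) - i) ≤ f j := by
  obtain ⟨j, hj⟩ := j
  have hij' : (i : ℕ) ≤ j := hij
  induction j with
  | zero =>
    have : i = ⟨0, hj⟩ := Fin.ext (by simpa using hij')
    simp [this]
  | succ j ih =>
    rcases Nat.eq_or_lt_of_le hij' with h | h
    · have : i = ⟨j + 1, hj⟩ := Fin.ext h
      simp [this]
    · have h1 := ih (by omega) (Fin.le_def.2 (by simp; omega)) (by omega)
      have h2 : f ⟨j, by omega⟩ < f ⟨j + 1, hj⟩ := hf (by simp [Fin.lt_def])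
      simp only at h1 ⊢
      omega

theorem IsDiagram.strictMono_positions {k n : ℕ} {lam : Fin k → ℕ} (h : IsDiagram k n lam) :
    StrictMono fun i : Fin k => lam i.rev + (i : ℕ) := by
  intro i j hij
  have := h.1 j.rev i.rev (Fin.rev_le_rev.2 hij.le)
  have : (i : ℕ) < j := hij
  simp only
  omega

theorem periodicWord_eq_true_iff {k n : ℕ} {lam : Fin k → ℕ} {z : ℕ} (hz : z < n) :
    periodicWord k n lam z = true ↔ z ∈ Set.range fun i : Fin k => lam i.rev + (i : ℕ) := by
  rw [periodicWord, decide_eq_true_eq, Nat.mod_eq_of_lt hz, Set.mem_range,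
    ← Fin.revPerm.exists_congr_right]
  refine exists_congr fun i => ?_
  have := i.isLt
  simp only [Fin.revPerm_apply, Fin.val_rev]
  omega

theorem IsDiagram.position_lt {k n : ℕ} (hkn : k ≤ n) {lam : Fin k → ℕ} (h : IsDiagram k n lam)
    (i : Fin k) : lam i.rev + (i : ℕ) < n := by
  have := h.2 i.rev
  have := i.isLt
  omega

theorem filter_periodicWord {k n : ℕ} (hkn : k ≤ n) {lam : Fin k → ℕ} (h : IsDiagram k n lam) :
    (Finset.range n).filter (fun z => periodicWord k n lam z = true) =
      Finset.univ.image fun i : Fin k => lam i.rev + (i : ℕ) := by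
  ext z
  simp only [Finset.mem_filter, Finset.mem_range, Finset.mem_image, Finset.mem_univ, true_and]
  constructor
  · rintro ⟨hz, hw⟩
    exact (periodicWord_eq_true_iff hz).1 hw
  · rintro ⟨i, rfl⟩
    exact ⟨h.position_lt hkn i, (periodicWord_eq_true_iff (h.position_lt hkn i)).2 ⟨i, rfl⟩⟩

theorem periodic_ext {n : ℕ} (hn : 0 < n) {p q : ℕ → Bool} (hp : Function.Periodic p n)
    (hq : Function.Periodic q n) (h : ∀ z < n, p z = q z) : p = q := by
  funext z
  rw [← hp.map_mod_nat z, ← hq.map_mod_nat z]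
  exact h _ (Nat.mod_lt _ hn)

theorem periodicWord_injOn {k n : ℕ} (hkn : k ≤ n) :
    Set.InjOn (periodicWord k n) {lam | IsDiagram k n lam} := by
  intro lam hlam mu hmu heq
  have himg : Set.range (fun i : Fin k => lam i.rev + (i : ℕ)) =
      Set.range fun i : Fin k => mu i.rev + (i : ℕ) := by
    have := (filter_periodicWord hkn hlam).symm.trans
      ((congrArg (fun p => (Finset.range n).filter fun z => p z = true) heq).trans
        (filter_periodicWord hkn hmu))
    simpa using congrArg (fun s : Finset ℕ => (s : Set ℕ)) this
  have hfun := (hlam.strictMono_positions.range_inj hmu.strictMono_positions).1 himg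
  funext i
  have := congrFun hfun i.rev
  simpa using this

theorem periodicWord_bijOn {k n : ℕ} (hk : 1 ≤ k) (hkn : k ≤ n) :
    Set.BijOn (periodicWord k n) {lam | IsDiagram k n lam} (periodicSeqs k n) := by
  refine ⟨fun lam hlam => ⟨periodicWord_periodic k n lam, ?_⟩, periodicWord_injOn hkn, ?_⟩
  · rw [Nat.count_eq_card_filter_range, filter_periodicWord hkn hlam,
      Finset.card_image_of_injective _ (IsDiagram.strictMono_positions hlam).injective,
      Finset.card_univ, Fintype.card_fin]
  · rintro p ⟨hp, hcount⟩
    rw [Nat.count_eq_card_filter_range] at hcount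
    set s := (Finset.range n).filter fun z => p z = true with hs
    set f := s.orderEmbOfFin hcount with hf
    have hmono : StrictMono f := f.strictMono
    have hge (i : Fin k) : (i : ℕ) ≤ f i := by
      have := add_sub_le_of_strictMono hmono (i := ⟨0, hk⟩) (j := i) (by simp [Fin.le_def])
      simp only at this
      omega
    have hlt (i : Fin k) : f i < n := by
      have : f i ∈ s := Finset.orderEmbOfFin_mem s hcount i
      rw [hs, Finset.mem_filter, Finset.mem_range] at this
      exact this.1
    refine ⟨fun j => f j.rev - (j.rev : ℕ), ⟨fun i j hij => ?_, fun i => ?_⟩, ?_⟩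
    · have := add_sub_le_of_strictMono hmono (Fin.rev_le_rev.2 hij)
      simp only
      omega
    · have := add_sub_le_of_strictMono hmono (i := i.rev) (j := ⟨k - 1, by omega⟩)
        (by simp only [Fin.le_def, Fin.val_rev]; omega)
      have := hlt ⟨k - 1, by omega⟩
      have := i.rev.isLt
      simp only at *
      omega
    · refine periodic_ext (by omega) (periodicWord_periodic _ _ _) hp fun z hz => ?_
      rw [Bool.eq_iff_iff, periodicWord_eq_true_iff hz]
      have hfun : (fun i : Fin k => f i.rev.rev - (i.rev.rev : ℕ) + (i : ℕ)) = f := by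
        funext i
        have := hge i
        simp only [Fin.rev_rev]
        omega
      rw [hfun, hf, Finset.range_orderEmbOfFin]
      simp [hs, hz]

theorem iterate_cyc_eq_iff {k n : ℕ} (hk : 1 ≤ k) (hkn : k ≤ n) {lam : Fin k → ℕ}
    (h : IsDiagram k n lam) (t : ℕ) :
    (cyc k n)^[t] lam = lam ↔ Function.Periodic (periodicWord k n lam) t := by
  have hshift := periodicWord_iterate_cyc hk hkn h t
  constructor
  · intro heq z
    simpa only [heq] using hshift z
  · intro hper
    refine periodicWord_injOn hkn (h.iterate_cyc t) h (funext fun z => ?_)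
    have hmul (q : ℕ → Bool) (hq : Function.Periodic q n) : q (z + t * n) = q z := by
      simpa using hq.nat_mul t z
    have ht : t ≤ t * n := Nat.le_mul_of_pos_right t (by omega)
    obtain ⟨r, hr⟩ := Nat.exists_eq_add_of_le ht
    have hsum : z + t * n = z + r + t := by omega
    rw [← hmul _ (periodicWord_periodic _ _ _), ← hmul _ (periodicWord_periodic k n lam), hsum,
      hshift, hper]

theorem orbLen_eq_iff {k n : ℕ} (hk : 1 ≤ k) (hkn : k ≤ n) {lam : Fin k → ℕ}
    (h : IsDiagram k n lam) :
    orbLen k n lam = n ↔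
      ∀ t, 0 < t → Function.Periodic (periodicWord k n lam) t → n ≤ t := by
  have hmem : n ∈ {t | 0 < t ∧ (cyc k n)^[t] lam = lam} :=
    ⟨by omega, (iterate_cyc_eq_iff hk hkn h n).2 (periodicWord_periodic k n lam)⟩
  unfold orbLen
  constructor
  · intro heq t ht hper
    rw [← heq]
    exact Nat.sInf_le ⟨ht, (iterate_cyc_eq_iff hk hkn h t).2 hper⟩
  · intro hmin
    refine le_antisymm (Nat.sInf_le hmem) (le_csInf ⟨n, hmem⟩ ?_)
    rintro t ⟨ht, heq⟩
    exact hmin t ht ((iterate_cyc_eq_iff hk hkn h t).1 heq)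

theorem NN_eq_ncard_primitiveSeqs {k n : ℕ} (hk : 1 ≤ k) (hkn : k ≤ n) :
    NN k n = (primitiveSeqs k n).ncard := by
  have hbij := periodicWord_bijOn hk hkn
  have himg : primitiveSeqs k n =
      periodicWord k n '' {lam | IsDiagram k n lam ∧ orbLen k n lam = n} := by
    ext p
    constructor
    · rintro ⟨hp, hmin⟩
      obtain ⟨lam, hlam, rfl⟩ := hbij.surjOn hp
      exact ⟨lam, ⟨hlam, (orbLen_eq_iff hk hkn hlam).2 hmin⟩, rfl⟩
    · rintro ⟨lam, ⟨hlam, horb⟩, rfl⟩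
      exact ⟨hbij.mapsTo hlam, (orbLen_eq_iff hk hkn hlam).1 horb⟩
  rw [himg, (hbij.injOn.mono fun lam h => h.1).ncard_image, NN]

theorem periodicSeqs_bijOn_powersetCard {k n : ℕ} (hn : 0 < n) :
    Set.BijOn (fun p : ℕ → Bool => (Finset.range n).filter fun z => p z = true)
      (periodicSeqs k n) ((Finset.range n).powersetCard k : Finset (Finset ℕ)) := by
  refine ⟨fun p hp => ?_, fun p hp q hq heq => ?_, fun s hs => ?_⟩
  · rw [Finset.mem_coe, Finset.mem_powersetCard, ← Nat.count_eq_card_filter_range]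
    exact ⟨Finset.filter_subset _ _, hp.2⟩
  · refine periodic_ext hn hp.1 hq.1 fun z hz => ?_
    have := Finset.ext_iff.1 heq z
    simp only [Finset.mem_filter, Finset.mem_range, hz, true_and] at this
    exact Bool.eq_iff_iff.2 this
  · rw [Finset.mem_coe, Finset.mem_powersetCard] at hs
    have hfilter : (Finset.range n).filter (fun z => decide (z % n ∈ s) = true) = s := by
      ext z
      simp only [Finset.mem_filter, Finset.mem_range, decide_eq_true_eq]
      constructor
      · rintro ⟨hz, hzs⟩
        rwa [Nat.mod_eq_of_lt hz] at hzs
      · intro hzs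
        have hz := Finset.mem_range.1 (hs.1 hzs)
        exact ⟨hz, by rwa [Nat.mod_eq_of_lt hz]⟩
    refine ⟨fun z => decide (z % n ∈ s), ⟨fun z => by simp, ?_⟩, hfilter⟩
    rw [Nat.count_eq_card_filter_range, hfilter, hs.2]

theorem count_mul_of_periodic {p : ℕ → Bool} {m : ℕ} (hp : Function.Periodic p m) (d : ℕ) :
    Nat.count (fun z => p z = true) (d * m) = d * Nat.count (fun z => p z = true) m := by
  induction d with
  | zero => simp
  | succ d ih =>
    have hshift (z : ℕ) : p (d * m + z) = p z := by
      rw [add_comm]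
      simpa using hp.nat_mul d z
    simp only [Nat.succ_mul, Nat.count_add, ih, hshift]

theorem primitiveSeqs_subset_periodicSeqs {k n d : ℕ} (hdk : d ∣ k) (hdn : d ∣ n) :
    primitiveSeqs (k / d) (n / d) ⊆ periodicSeqs k n := by
  rintro p ⟨⟨hp, hcount⟩, -⟩
  refine ⟨?_, ?_⟩
  · have := hp.nat_mul d
    rwa [Nat.cast_id, Nat.mul_div_cancel' hdn] at this
  · have := count_mul_of_periodic hp d
    rwa [hcount, Nat.mul_div_cancel' hdn, Nat.mul_div_cancel' hdk] at this

theorem exists_mem_primitiveSeqs {k n : ℕ} (hn : 0 < n) {p : ℕ → Bool}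
    (hp : p ∈ periodicSeqs k n) :
    ∃ d, d ∣ k ∧ d ∣ n ∧ p ∈ primitiveSeqs (k / d) (n / d) := by
  classical
  obtain ⟨hper, hcount⟩ := hp
  have hex : ∃ t, 0 < t ∧ Function.Periodic p t := ⟨n, hn, hper⟩
  obtain ⟨hm, hmper⟩ := Nat.find_spec hex
  have hmin (t : ℕ) (ht : 0 < t) (htper : Function.Periodic p t) : Nat.find hex ≤ t :=
    Nat.find_min' hex ⟨ht, htper⟩
  generalize Nat.find hex = m at hm hmper hmin
  have hdvd : m ∣ n := by
    by_contra hnd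
    have hpos : 0 < n % m := Nat.pos_of_ne_zero fun h => hnd (Nat.dvd_of_mod_eq_zero h)
    refine absurd (hmin _ hpos fun z => ?_) (not_le.2 (Nat.mod_lt _ hm))
    have h1 : p (z + n % m + n / m * m) = p (z + n % m) := by
      simpa using hmper.nat_mul (n / m) (z + n % m)
    rw [← h1, add_assoc, Nat.mod_add_div', hper]
  obtain ⟨d, rfl⟩ := hdvd
  have hd : 0 < d := Nat.pos_of_mul_pos_left hn
  have hk : k = d * Nat.count (fun z => p z = true) m := by
    rw [← hcount, mul_comm m d, count_mul_of_periodic hmper]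
  refine ⟨d, ⟨_, hk⟩, Dvd.intro_left m rfl, ?_⟩
  rw [Nat.mul_div_cancel _ hd, hk, Nat.mul_div_cancel_left _ hd]
  exact ⟨⟨hmper, rfl⟩, hmin⟩

theorem primitiveSeqs_eq_of_mem {k l m n : ℕ} (hm : 0 < m) (hn : 0 < n) {p : ℕ → Bool}
    (h1 : p ∈ primitiveSeqs k m) (h2 : p ∈ primitiveSeqs l n) : m = n :=
  le_antisymm (h1.2 n hn h2.1.1) (h2.2 m hm h1.1.1)

/-- `C(n,k) = ∑_{d ∣ gcd(k,n)} N_{k/d, n/d}`, sum over positive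
divisors `d` of `gcd(k,n)`. -/
theorem choose_eq_sum_NN (k n : ℕ) (hk : 1 ≤ k) (hkn : k ≤ n) :
    Nat.choose n k = ∑ d ∈ (Nat.gcd k n).divisors, NN (k / d) (n / d) := by
  have hn : 0 < n := by omega
  have hbij := periodicSeqs_bijOn_powersetCard (k := k) hn
  have hfin : (periodicSeqs k n).Finite := hbij.finite_iff_finite.2 (Finset.finite_toSet _)
  have hdvd (d : ℕ) (hd : d ∈ (Nat.gcd k n).divisors) : d ∣ k ∧ d ∣ n :=
    Nat.dvd_gcd_iff.1 (Nat.dvd_of_mem_divisors hd)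
  have hpos (d : ℕ) (hd : d ∈ (Nat.gcd k n).divisors) : 0 < n / d :=
    Nat.div_pos (Nat.le_of_dvd hn (hdvd d hd).2) (Nat.pos_of_mem_divisors hd)
  have hfin' (d : ℕ) (hd : d ∈ (Nat.gcd k n).divisors) : (primitiveSeqs (k / d) (n / d)).Finite :=
    hfin.subset (primitiveSeqs_subset_periodicSeqs (hdvd d hd).1 (hdvd d hd).2)
  have hunion : periodicSeqs k n =
      ⋃ d ∈ (Nat.gcd k n).divisors, primitiveSeqs (k / d) (n / d) := by
    ext p
    simp only [Set.mem_iUnion, exists_prop]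
    constructor
    · intro hp
      obtain ⟨d, hdk, hdn, hd⟩ := exists_mem_primitiveSeqs hn hp
      exact ⟨d, Nat.mem_divisors.2 ⟨Nat.dvd_gcd hdk hdn, (Nat.gcd_pos_of_pos_right k hn).ne'⟩, hd⟩
    · rintro ⟨d, hd, hp⟩
      exact primitiveSeqs_subset_periodicSeqs (hdvd d hd).1 (hdvd d hd).2 hp
  have hdisj : ((Nat.gcd k n).divisors : Set ℕ).PairwiseDisjoint
      fun d => primitiveSeqs (k / d) (n / d) := by
    intro d hd e he hne
    refine Set.disjoint_left.2 fun p hpd hpe => hne ?_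
    have heq := primitiveSeqs_eq_of_mem (hpos d hd) (hpos e he) hpd hpe
    have h1 := Nat.mul_div_cancel' (hdvd d hd).2
    have h2 := Nat.mul_div_cancel' (hdvd e he).2
    rw [← heq] at h2
    exact Nat.eq_of_mul_eq_mul_right (hpos d hd) (h1.trans h2.symm)
  calc Nat.choose n k = ((Finset.range n).powersetCard k).card := by
        rw [Finset.card_powersetCard, Finset.card_range]
    _ = (periodicSeqs k n).ncard := by
        rw [← Set.ncard_coe_finset, ← hbij.image_eq, hbij.injOn.ncard_image]
    _ = ∑ d ∈ (Nat.gcd k n).divisors, (primitiveSeqs (k / d) (n / d)).ncard := by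
        rw [hunion, ← finsum_mem_coe_finset]
        exact (Finset.finite_toSet _).ncard_biUnion hfin' hdisj
    _ = ∑ d ∈ (Nat.gcd k n).divisors, NN (k / d) (n / d) := by
        refine Finset.sum_congr rfl fun d hd => (NN_eq_ncard_primitiveSeqs ?_ ?_).symm
        · exact Nat.div_pos (Nat.le_of_dvd hk (hdvd d hd).1) (Nat.pos_of_mem_divisors hd)
        · exact Nat.div_le_div_right hkn
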